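/- arXiv:2512.13841 — 6 statements merged into one kernel-verified Lean document; each statement's English description precedes it below -/
import Mathlib

section
/- Fix real parameters α ∈ (1,2), β > 0 and γ ≠ 0. For t ≥ 0 and λ > 0 define u_t(λ) = e^{-γt}·(λ^{1-α} + (β/γ)(1 - e^{γ(1-α)t}))^{1/(1-α)} (real powers). Then the flow (semigroup) property holds: for all s, t ≥ 0 and all λ > 0, u_{t+s}(λ) = u_t(u_s(λ)). -/
open Real Filter

/-- The cumulant `u_t(λ)` of the stable CSBP satisfies the flow
(semigroup) property `u_{t+s}(λ) = u_t(u_s(λ))`. -/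
theorem stmt1 (α β γ : ℝ) (hα : 1 < α) (hα2 : α < 2) (hβ : 0 < β) (hγ : γ ≠ 0)
    (u : ℝ → ℝ → ℝ)
    (hu : ∀ t lam : ℝ, u t lam =
      Real.exp (-γ * t) *
        (lam ^ (1 - α) + (β / γ) * (1 - Real.exp (γ * (1 - α) * t))) ^ (1 / (1 - α))) :
    ∀ s t : ℝ, 0 ≤ s → 0 ≤ t → ∀ lam : ℝ, 0 < lam →
      u (t + s) lam = u t (u s lam) := by
  have hc : 1 - α ≠ 0 := by linarith
  have key : ∀ t : ℝ, 0 ≤ t → 0 ≤ (β / γ) * (1 - Real.exp (γ * (1 - α) * t)) := by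
    intro t ht
    rcases lt_or_gt_of_ne hγ with h | h
    · have h1 : 1 ≤ Real.exp (γ * (1 - α) * t) := by
        apply Real.one_le_exp
        exact mul_nonneg (mul_nonneg_of_nonpos_of_nonpos h.le (by linarith)) ht
      exact mul_nonneg_of_nonpos_of_nonpos (div_nonpos_of_nonneg_of_nonpos hβ.le h.le)
        (by linarith)
    · have h1 : Real.exp (γ * (1 - α) * t) ≤ 1 := by
        apply Real.exp_le_one_iff.mpr
        exact mul_nonpos_of_nonpos_of_nonneg
          (mul_nonpos_of_nonneg_of_nonpos h.le (by linarith)) ht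
      exact mul_nonneg (div_nonneg hβ.le h.le) (by linarith)
  intro s t hs ht lam hlam
  have hl : 0 < lam ^ (1 - α) := Real.rpow_pos_of_pos hlam _
  have hA := add_pos_of_pos_of_nonneg hl (key s hs)
  have hB := add_pos_of_pos_of_nonneg hl (key (t + s) (by linarith))
  have h1 : (u s lam) ^ (1 - α) = Real.exp (-(γ * (1 - α) * s)) *
      (lam ^ (1 - α) + (β / γ) * (1 - Real.exp (γ * (1 - α) * s))) := by
    rw [hu, Real.mul_rpow (Real.exp_pos _).le (Real.rpow_nonneg hA.le _),
      ← Real.rpow_mul hA.le, one_div_mul_cancel hc, Real.rpow_one, ← Real.exp_mul]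
    congr 2
    ring
  have h2 : (u s lam) ^ (1 - α) + (β / γ) * (1 - Real.exp (γ * (1 - α) * t)) =
      Real.exp (-(γ * (1 - α) * s)) *
      (lam ^ (1 - α) + (β / γ) * (1 - Real.exp (γ * (1 - α) * (t + s)))) := by
    have e1 : Real.exp (-(γ * (1 - α) * s)) * Real.exp (γ * (1 - α) * s) = 1 := by
      rw [← Real.exp_add]; simp
    rw [h1, mul_add (γ * (1 - α)) t s, Real.exp_add]
    linear_combination (β / γ) * (Real.exp (γ * (1 - α) * t) - 1) * e1
  rw [hu t (u s lam), h2, Real.mul_rpow (Real.exp_pos _).le hB.le, ← Real.exp_mul,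
    ← mul_assoc, ← Real.exp_add, hu]
  congr 2
  field_simp
  ring
end

section
/- Fix real parameters α ∈ (1,2), β > 0, γ ≠ 0, t > 0 and x > 0. Define u_t(λ) = e^{-γt}·(λ^{1-α} + (β/γ)(1 - e^{γ(1-α)t}))^{1/(1-α)} for λ > 0, u_t(∞) = e^{-γt}·(γ/(β(1 - e^{γ(1-α)t})))^{1/(α-1)}, and p = exp(-x·u_t(∞)) (real powers). Then the function λ ↦ λ·(exp(-x·u_t(λ)) - p)/(1 - p) tends to +∞ as λ → ∞. -/
open Real Filter

/-- initial value theorem side: with `p = exp(-x u_t(∞))`,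
`λ (exp(-x u_t(λ)) - p)/(1 - p) → +∞` as `λ → ∞`. -/
theorem stmt5 (α β γ t x : ℝ) (hα : 1 < α) (hα2 : α < 2) (hβ : 0 < β) (hγ : γ ≠ 0)
    (ht : 0 < t) (hx : 0 < x)
    (u : ℝ → ℝ)
    (hu : ∀ lam : ℝ, u lam =
      Real.exp (-γ * t) *
        (lam ^ (1 - α) + (β / γ) * (1 - Real.exp (γ * (1 - α) * t))) ^ (1 / (1 - α)))
    (uInf p : ℝ)
    (huInf : uInf = Real.exp (-γ * t) *
      (γ / (β * (1 - Real.exp (γ * (1 - α) * t)))) ^ (1 / (α - 1)))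
    (hp : p = Real.exp (-x * uInf)) :
    Filter.Tendsto (fun lam : ℝ => lam * ((Real.exp (-x * u lam) - p) / (1 - p)))
      Filter.atTop Filter.atTop := by
  have hc : 0 < (β / γ) * (1 - Real.exp (γ * (1 - α) * t)) := by
    rcases lt_or_gt_of_ne hγ with h | h
    · have h1 : 1 < Real.exp (γ * (1 - α) * t) := by
        rw [Real.one_lt_exp_iff]
        exact mul_pos (mul_pos_of_neg_of_neg h (by linarith)) ht
      exact mul_pos_of_neg_of_neg (div_neg_of_pos_of_neg hβ h) (by linarith)
    · have h1 : Real.exp (γ * (1 - α) * t) < 1 := by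
        rw [Real.exp_lt_one_iff]
        exact mul_neg_of_neg_of_pos (mul_neg_of_pos_of_neg h (by linarith)) ht
      exact mul_pos (div_pos hβ h) (by linarith)
  have hinv : γ / (β * (1 - Real.exp (γ * (1 - α) * t)))
      = ((β / γ) * (1 - Real.exp (γ * (1 - α) * t)))⁻¹ := by
    rw [div_mul_eq_mul_div, inv_div]
  rw [hinv] at huInf
  generalize (β / γ) * (1 - Real.exp (γ * (1 - α) * t)) = c at *
  have hq : 1 / (α - 1) = -(1 / (1 - α)) := by
    rw [← neg_sub 1 α, div_neg]
  rw [hq, Real.rpow_neg (inv_nonneg.2 hc.le), Real.inv_rpow hc.le, inv_inv] at huInf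
  have hq0 : 1 / (1 - α) < 0 := div_neg_of_pos_of_neg one_pos (by linarith)
  generalize 1 / (1 - α) = q at *
  have hE : 0 < Real.exp (-γ * t) := Real.exp_pos _
  generalize Real.exp (-γ * t) = E at *
  have hp1 : p < 1 := by
    rw [hp, Real.exp_lt_one_iff, huInf]
    have : 0 < x * (E * c ^ q) := by positivity
    linarith
  have hd : HasDerivAt (fun y : ℝ => Real.exp (-x * (E * (y + c) ^ q)))
      (Real.exp (-x * (E * (0 + c) ^ q)) * (-x * (E * (1 * q * (0 + c) ^ (q - 1))))) 0 :=
    (((((hasDerivAt_id (0:ℝ)).add_const c).rpow_const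
      (Or.inl (by simpa using hc.ne'))).const_mul E).const_mul (-x)).exp
  have hk : 0 < Real.exp (-x * (E * (0 + c) ^ q)) * (-x * (E * (1 * q * (0 + c) ^ (q - 1)))) := by
    have h1 : 0 < x * (E * (-q * (0 + c) ^ (q - 1))) := by
      have : 0 < -q := by linarith
      rw [zero_add]
      positivity
    exact mul_pos (Real.exp_pos _) (by linarith)
  generalize Real.exp (-x * (E * (0 + c) ^ q)) * (-x * (E * (1 * q * (0 + c) ^ (q - 1)))) = k at *
  have hs : Tendsto (fun lam : ℝ => lam ^ (1 - α)) atTop (nhdsWithin 0 {0}ᶜ) := by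
    refine tendsto_nhdsWithin_iff.2 ⟨?_, ?_⟩
    · have := tendsto_rpow_neg_atTop (y := α - 1) (by linarith)
      simpa using this
    · filter_upwards [eventually_gt_atTop 0] with l hl
      exact (Real.rpow_pos_of_pos hl _).ne'
  have h2 := (hasDerivAt_iff_tendsto_slope.1 hd).comp hs
  have h3 : Tendsto (fun lam : ℝ => lam ^ (2 - α)) atTop atTop :=
    tendsto_rpow_atTop (by linarith)
  have h4 := (h3.atTop_mul_pos hk h2).atTop_div_const (sub_pos.2 hp1)
  refine h4.congr' ?_
  filter_upwards [eventually_gt_atTop 0] with l hl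
  have hl1 : 0 < l ^ (1 - α) := Real.rpow_pos_of_pos hl _
  have e : l ^ (2 - α) = l * l ^ (1 - α) := by
    rw [show 2 - α = 1 + (1 - α) by ring, Real.rpow_add hl, Real.rpow_one]
  simp only [Function.comp, slope_def_field, hu, hp, huInf, e, zero_add, sub_zero]
  generalize l ^ (1 - α) = s at *
  field_simp
end

section
/- Fix real parameters α ∈ (1,2), β > 0, γ ≠ 0, t > 0 and x > 0. Define u_t(λ) = e^{-γt}·(λ^{1-α} + (β/γ)(1 - e^{γ(1-α)t}))^{1/(1-α)} for λ > 0, u_t(∞) = e^{-γt}·(γ/(β(1 - e^{γ(1-α)t})))^{1/(α-1)}, and p = exp(-x·u_t(∞)) (real powers). Then (1 - (exp(-x·u_t(λ)) - p)/(1 - p))/λ tends to x·e^{-γt}/(1 - p) as λ → 0 from the right. -/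
open Real Filter

/-- with `p = exp(-x u_t(∞))`,
`(1 - (exp(-x u_t(λ)) - p)/(1 - p))/λ → x e^{-γt}/(1 - p)` as `λ → 0⁺`. -/
theorem stmt9 (α β γ t x : ℝ) (hα : 1 < α) (hα2 : α < 2) (hβ : 0 < β) (hγ : γ ≠ 0)
    (ht : 0 < t) (hx : 0 < x)
    (u : ℝ → ℝ)
    (hu : ∀ lam : ℝ, u lam =
      Real.exp (-γ * t) *
        (lam ^ (1 - α) + (β / γ) * (1 - Real.exp (γ * (1 - α) * t))) ^ (1 / (1 - α)))
    (uInf p : ℝ)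
    (huInf : uInf = Real.exp (-γ * t) *
      (γ / (β * (1 - Real.exp (γ * (1 - α) * t)))) ^ (1 / (α - 1)))
    (hp : p = Real.exp (-x * uInf)) :
    Filter.Tendsto
      (fun lam : ℝ => (1 - (Real.exp (-x * u lam) - p) / (1 - p)) / lam)
      (nhdsWithin 0 (Set.Ioi 0)) (nhds (x * Real.exp (-γ * t) / (1 - p))) := by
  have hpos : 0 < (1 - Real.exp (γ * (1 - α) * t)) / γ := by
    rcases lt_or_gt_of_ne hγ with h | h
    · apply div_pos_of_neg_of_neg _ h
      have : 0 < γ * (1 - α) * t := mul_pos (mul_pos_of_neg_of_neg h (by linarith)) ht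
      have := Real.one_lt_exp_iff.2 this
      linarith
    · apply div_pos _ h
      have : γ * (1 - α) * t < 0 :=
        mul_neg_of_neg_of_pos (mul_neg_of_pos_of_neg h (by linarith)) ht
      have := Real.exp_lt_one_iff.2 this
      linarith
  obtain ⟨c, hc⟩ : ∃ c, c = (β / γ) * (1 - Real.exp (γ * (1 - α) * t)) := ⟨_, rfl⟩
  have hcpos : 0 < c := by
    have : c = β * ((1 - Real.exp (γ * (1 - α) * t)) / γ) := by rw [hc]; ring
    rw [this]; positivity
  have hinv : γ / (β * (1 - Real.exp (γ * (1 - α) * t))) = c⁻¹ := by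
    rw [hc, mul_inv, inv_div, div_mul_eq_div_div, div_eq_mul_inv]
  have huI : 0 < uInf := by
    rw [huInf, hinv]; positivity
  have hp1 : p < 1 := by
    rw [hp]; apply Real.exp_lt_one_iff.2; nlinarith
  have hp0 : 1 - p ≠ 0 := by linarith
  simp only [← hc] at hu
  clear hinv hpos huInf
  -- the normalised function
  obtain ⟨g, hg⟩ : ∃ g : ℝ → ℝ, g = fun lam => Real.exp (-γ * t) *
      (1 + c * lam ^ (α - 1)) ^ (1 / (1 - α)) := ⟨_, rfl⟩
  have hug : ∀ lam : ℝ, 0 < lam → u lam = lam * g lam := by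
    intro lam hl
    have h1 : lam ^ (1 - α) + c = lam ^ (1 - α) * (1 + c * lam ^ (α - 1)) := by
      have : lam ^ (1 - α) * lam ^ (α - 1) = 1 := by
        rw [← Real.rpow_add hl]; simp
      linear_combination (-c) * this
    have h2 : (lam ^ (1 - α)) ^ (1 / (1 - α)) = lam := by
      rw [← Real.rpow_mul hl.le, mul_one_div_cancel (by linarith), Real.rpow_one]
    rw [hu, h1, Real.mul_rpow (by positivity) (by positivity), h2, hg]
    ring
  have hgt : Tendsto g (nhdsWithin 0 (Set.Ioi 0)) (nhds (Real.exp (-γ * t))) := by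
    have h1 : ContinuousAt (fun lam : ℝ => lam ^ (α - 1)) 0 :=
      Real.continuousAt_rpow_const _ _ (Or.inr (by linarith))
    have h0 : (0:ℝ) ^ (α - 1) = 0 := Real.zero_rpow (by linarith)
    have h2 : ContinuousAt g 0 := by
      rw [hg]
      refine continuousAt_const.mul (ContinuousAt.rpow_const
        (continuousAt_const.add (continuousAt_const.mul h1)) (Or.inl ?_))
      rw [h0]; norm_num
    have h3 : g 0 = Real.exp (-γ * t) := by rw [hg]; simp [h0]
    have h4 := h2.tendsto
    rw [h3] at h4
    exact h4.mono_left nhdsWithin_le_nhds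
  have hid : Tendsto (fun lam : ℝ => lam) (nhdsWithin 0 (Set.Ioi 0)) (nhds 0) :=
    tendsto_id.mono_left nhdsWithin_le_nhds
  have hy : Tendsto (fun lam => -x * (lam * g lam)) (nhdsWithin 0 (Set.Ioi 0)) (nhds 0) := by
    simpa using (hid.mul hgt).const_mul (-x)
  have hd : Tendsto (dslope Real.exp 0) (nhds 0) (nhds 1) := by
    have : ContinuousAt (dslope Real.exp 0) 0 :=
      continuousAt_dslope_same.2 Real.differentiableAt_exp
    simpa [ContinuousAt, dslope_same] using this
  have hlim := ((hgt.const_mul x).mul (hd.comp hy)).div_const (1 - p)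
  rw [mul_one] at hlim
  refine hlim.congr' ?_
  filter_upwards [self_mem_nhdsWithin] with lam hl
  have hl : 0 < lam := hl
  have hs := sub_smul_dslope Real.exp 0 (-x * (lam * g lam))
  simp only [sub_zero, smul_eq_mul, Real.exp_zero] at hs
  rw [hug lam hl]
  simp only [Function.comp]
  generalize dslope Real.exp 0 (-x * (lam * g lam)) = D at *
  generalize Real.exp (-x * (lam * g lam)) = E at *
  field_simp
  linear_combination -hs
end

section
/- Fix real parameters α ∈ (1,2), β > 0, γ ≠ 0, t > 0 and x > 0. Define u_t(λ) = e^{-γt}·(λ^{1-α} + (β/γ)(1 - e^{γ(1-α)t}))^{1/(1-α)} for λ > 0, u_t(∞) = e^{-γt}·(γ/(β(1 - e^{γ(1-α)t})))^{1/(α-1)}, and p = exp(-x·u_t(∞)) (real powers). Then λ^{α-1}·(exp(-x·u_t(λ)) - p)/(1 - p) tends, as λ → ∞, to the finite positive constant (x·p/(1-p))·(e^{-γt}/(α-1))·(γ/(β(1 - e^{γ(1-α)t})))^{α/(α-1)}. -/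
open Real Filter

/-- with `p = exp(-x u_t(∞))`, as `λ → ∞`,
`λ^{α-1} (exp(-x u_t(λ)) - p)/(1 - p)` tends to
`(x p/(1-p)) (e^{-γt}/(α-1)) (γ/(β(1 - e^{γ(1-α)t})))^{α/(α-1)}`. -/
theorem stmt10 (α β γ t x : ℝ) (hα : 1 < α) (hα2 : α < 2) (hβ : 0 < β) (hγ : γ ≠ 0)
    (ht : 0 < t) (hx : 0 < x)
    (u : ℝ → ℝ)
    (hu : ∀ lam : ℝ, u lam =
      Real.exp (-γ * t) *
        (lam ^ (1 - α) + (β / γ) * (1 - Real.exp (γ * (1 - α) * t))) ^ (1 / (1 - α)))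
    (uInf p : ℝ)
    (huInf : uInf = Real.exp (-γ * t) *
      (γ / (β * (1 - Real.exp (γ * (1 - α) * t)))) ^ (1 / (α - 1)))
    (hp : p = Real.exp (-x * uInf)) :
    Filter.Tendsto
      (fun lam : ℝ => lam ^ (α - 1) * ((Real.exp (-x * u lam) - p) / (1 - p)))
      Filter.atTop
      (nhds ((x * p / (1 - p)) * (Real.exp (-γ * t) / (α - 1)) *
        (γ / (β * (1 - Real.exp (γ * (1 - α) * t)))) ^ (α / (α - 1)))) := by
  have hc : 0 < (β / γ) * (1 - Real.exp (γ * (1 - α) * t)) := by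
    rcases lt_or_gt_of_ne hγ with h | h
    · have h1 : 1 < Real.exp (γ * (1 - α) * t) := by
        rw [Real.one_lt_exp_iff]
        exact mul_pos (mul_pos_of_neg_of_neg h (by linarith)) ht
      exact mul_pos_of_neg_of_neg (div_neg_of_pos_of_neg hβ h) (by linarith)
    · have h1 : Real.exp (γ * (1 - α) * t) < 1 := by
        rw [Real.exp_lt_one_iff]
        exact mul_neg_of_neg_of_pos (mul_neg_of_pos_of_neg h (by linarith)) ht
      exact mul_pos (div_pos hβ h) (by linarith)
  have hG : γ / (β * (1 - Real.exp (γ * (1 - α) * t))) =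
      ((β / γ) * (1 - Real.exp (γ * (1 - α) * t)))⁻¹ := by
    rw [mul_inv, inv_div, div_mul_eq_div_div, div_eq_mul_inv (γ / β)]
  rw [hG] at huInf ⊢
  generalize (β / γ) * (1 - Real.exp (γ * (1 - α) * t)) = c at *
  generalize Real.exp (-γ * t) = e at *
  have ha : α - 1 ≠ 0 := by linarith
  have ha' : 1 - α ≠ 0 := by linarith
  have hinv : ∀ y : ℝ, c⁻¹ ^ y = c ^ (-y) := fun y => by
    rw [Real.inv_rpow hc.le, Real.rpow_neg hc.le]
  have e1 : -(1 / (α - 1)) = 1 / (1 - α) := by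
    rw [← neg_sub α 1]; field_simp
  have e2 : -(α / (α - 1)) = 1 / (1 - α) - 1 := by
    rw [← e1]; field_simp; ring
  rw [hinv, e1] at huInf
  rw [hinv, e2]
  have hd : HasDerivAt (fun s : ℝ => Real.exp (-x * (e * (s + c) ^ (1 / (1 - α)))))
      (Real.exp (-x * (e * (0 + c) ^ (1 / (1 - α)))) *
        (-x * (e * (1 * (1 / (1 - α)) * (0 + c) ^ (1 / (1 - α) - 1))))) 0 := by
    have h1 : HasDerivAt (fun s : ℝ => s + c) 1 0 := (hasDerivAt_id 0).add_const c
    have h2 := h1.rpow_const (p := 1 / (1 - α)) (Or.inl (by simpa using hc.ne'))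
    have h3 := ((h2.const_mul e).const_mul (-x)).exp
    convert h3 using 1
  have hs := hd.tendsto_slope_zero
  have hl : Tendsto (fun lam : ℝ => lam ^ (1 - α)) atTop (nhdsWithin 0 {0}ᶜ) := by
    rw [tendsto_nhdsWithin_iff]
    constructor
    · have := tendsto_rpow_neg_atTop (y := α - 1) (by linarith)
      simpa using this
    · filter_upwards [eventually_gt_atTop 0] with l hl
      exact (Real.rpow_pos_of_pos hl _).ne'
  have hm := (hs.comp hl).div_const (1 - p)
  simp only [zero_add, ← huInf, ← hp] at hm
  refine (hm.congr' ?_).trans (le_of_eq ?_)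
  · filter_upwards [eventually_gt_atTop 0] with l hl
    simp only [Function.comp, smul_eq_mul, hu]
    rw [← Real.rpow_neg hl.le, neg_sub, mul_div_assoc]
  · congr 1
    rw [← e1]
    ring
end

section
/- Fix real parameters α ∈ (1,2), β > 0, γ ≠ 0 and t > 0. Define u_t(λ) = e^{-γt}·(λ^{1-α} + (β/γ)(1 - e^{γ(1-α)t}))^{1/(1-α)} for λ > 0 and u_t(∞) = e^{-γt}·(γ/(β(1 - e^{γ(1-α)t})))^{1/(α-1)} (real powers). Then λ^{α-1}·(u_t(∞) - u_t(λ)) tends, as λ → ∞, to the finite positive constant (e^{-γt}/(α-1))·(γ/(β(1 - e^{γ(1-α)t})))^{α/(α-1)}. -/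
open Real Filter

/-- as `λ → ∞`, `λ^{α-1} (u_t(∞) - u_t(λ))` tends to
`(e^{-γt}/(α-1)) (γ/(β(1 - e^{γ(1-α)t})))^{α/(α-1)}`. -/
theorem stmt11 (α β γ t : ℝ) (hα : 1 < α) (hα2 : α < 2) (hβ : 0 < β) (hγ : γ ≠ 0)
    (ht : 0 < t)
    (u : ℝ → ℝ)
    (hu : ∀ lam : ℝ, u lam =
      Real.exp (-γ * t) *
        (lam ^ (1 - α) + (β / γ) * (1 - Real.exp (γ * (1 - α) * t))) ^ (1 / (1 - α)))
    (uInf : ℝ)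
    (huInf : uInf = Real.exp (-γ * t) *
      (γ / (β * (1 - Real.exp (γ * (1 - α) * t)))) ^ (1 / (α - 1))) :
    Filter.Tendsto (fun lam : ℝ => lam ^ (α - 1) * (uInf - u lam))
      Filter.atTop
      (nhds ((Real.exp (-γ * t) / (α - 1)) *
        (γ / (β * (1 - Real.exp (γ * (1 - α) * t)))) ^ (α / (α - 1)))) := by
  have h1 : 0 < α - 1 := by linarith
  have h1n : 1 - α ≠ 0 := by linarith
  have hC : 0 < (β / γ) * (1 - Real.exp (γ * (1 - α) * t)) := by
    rcases lt_or_gt_of_ne hγ with h | h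
    · have : 1 < Real.exp (γ * (1 - α) * t) := by
        rw [Real.one_lt_exp_iff]
        exact mul_pos (mul_pos_of_neg_of_neg h (by linarith)) ht
      exact mul_pos_of_neg_of_neg (div_neg_of_pos_of_neg hβ h) (by linarith)
    · have : Real.exp (γ * (1 - α) * t) < 1 := by
        rw [Real.exp_lt_one_iff]
        exact mul_neg_of_neg_of_pos (mul_neg_of_pos_of_neg h (by linarith)) ht
      exact mul_pos (div_pos hβ h) (by linarith)
  have hinv : γ / (β * (1 - Real.exp (γ * (1 - α) * t)))
      = ((β / γ) * (1 - Real.exp (γ * (1 - α) * t)))⁻¹ := by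
    rw [mul_inv, inv_div, div_mul_eq_div_div, div_eq_mul_inv (γ / β)]
  rw [hinv] at huInf ⊢
  generalize (β / γ) * (1 - Real.exp (γ * (1 - α) * t)) = C at *
  have e1 : 1 / (α - 1) = -(1 / (1 - α)) := by
    rw [← neg_sub, div_neg]
  have e2 : α / (α - 1) = -(1 / (1 - α) - 1) := by
    field_simp; ring
  have hd := (Real.hasDerivAt_rpow_const (x := C) (p := 1 / (1 - α)) (Or.inl hC.ne'))
  rw [hasDerivAt_iff_tendsto_slope_zero] at hd
  have hlim : Tendsto (fun l : ℝ => l ^ (1 - α)) atTop (nhdsWithin 0 {0}ᶜ) := by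
    rw [tendsto_nhdsWithin_iff]
    constructor
    · have := tendsto_rpow_neg_atTop h1
      simpa using this
    · filter_upwards [eventually_gt_atTop 0] with l hl
      exact (Real.rpow_pos_of_pos hl _).ne'
  have hk := ((hd.comp hlim).const_mul (-Real.exp (-γ * t)))
  have e3 : Real.exp (-γ * t) / (α - 1) * C⁻¹ ^ (α / (α - 1)) =
      -Real.exp (-γ * t) * (1 / (1 - α) * C ^ (1 / (1 - α) - 1)) := by
    rw [e2, Real.inv_rpow hC.le, Real.rpow_neg hC.le, inv_inv, div_eq_mul_one_div, e1]
    ring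
  rw [e3]
  refine hk.congr' ?_
  filter_upwards [eventually_gt_atTop 0] with l hl
  have e4 : l ^ (α - 1) = (l ^ (1 - α))⁻¹ := by
    rw [← Real.rpow_neg hl.le, neg_sub]
  simp only [Function.comp, smul_eq_mul]
  rw [hu, huInf, e4, e1, Real.inv_rpow hC.le, Real.rpow_neg hC.le, inv_inv, add_comm C]
  ring
end

section
/- Fix a real number α ∈ (1,2) and a real number u > 0. Then the Lebesgue integral over (0,∞) of the function x ↦ (e^{-ux} - 1 + ux)·x^{-1-α} is finite and equals Γ(2-α)/(α·(α-1)) · u^α, where Γ is the real Gamma function and u^α is the real power. -/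
open Real MeasureTheory

lemma aux_exp_quad (t : ℝ) (ht : 0 ≤ t) : Real.exp (-t) - 1 + t ≤ t ^ 2 := by
  have h1 : t + 1 ≤ Real.exp t := Real.add_one_le_exp t
  have h2 : Real.exp (-t) * Real.exp t = 1 := by rw [← Real.exp_add]; simp
  have h3 : 0 < Real.exp (-t) := Real.exp_pos _
  have h4 : Real.exp (-t) * (t + 1) ≤ 1 := by
    exact (mul_le_mul_of_nonneg_left h1 h3.le).trans h2.le
  have h5 : Real.exp (-t) * (t + 1) ≤ (1 - t + t ^ 2) * (t + 1) := by
    have : 0 ≤ t ^ 3 := by positivity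
    nlinarith
  have := le_of_mul_le_mul_right h5 (by linarith)
  linarith

lemma aux_int (α u : ℝ) (hα : 1 < α) (hα2 : α < 2) (hu : 0 < u) :
    IntegrableOn (fun x : ℝ => (Real.exp (-u * x) - 1 + u * x) * x ^ (-1 - α))
        (Set.Ioi (0 : ℝ)) := by
  have hc : ContinuousOn (fun x : ℝ => (Real.exp (-u * x) - 1 + u * x) * x ^ (-1 - α))
      (Set.Ioi (0 : ℝ)) := by
    apply ContinuousOn.mul
    · fun_prop
    · intro x hx
      exact (Real.continuousAt_rpow_const x _ (Or.inl (ne_of_gt hx))).continuousWithinAt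
  have hnn : ∀ x : ℝ, 0 ≤ Real.exp (-u * x) - 1 + u * x := by
    intro x
    have := Real.add_one_le_exp (-u * x)
    linarith
  rw [← Set.Ioc_union_Ioi_eq_Ioi (zero_le_one (α := ℝ)), integrableOn_union]
  constructor
  · have hi : IntegrableOn (fun x : ℝ => u ^ 2 * x ^ (1 - α)) (Set.Ioc 0 1) := by
      have := (intervalIntegral.intervalIntegrable_rpow' (a := 0) (b := 1)
        (r := 1 - α) (by linarith)).const_mul (u ^ 2)
      rwa [intervalIntegrable_iff_integrableOn_Ioc_of_le zero_le_one] at this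
    refine Integrable.mono' hi ((hc.mono Set.Ioc_subset_Ioi_self).aestronglyMeasurable
      measurableSet_Ioc) ?_
    refine (ae_restrict_iff' measurableSet_Ioc).2 (Filter.Eventually.of_forall ?_)
    intro x hx
    have hx0 : 0 < x := hx.1
    rw [Real.norm_of_nonneg (mul_nonneg (hnn x) (Real.rpow_nonneg hx0.le _))]
    have h1 := aux_exp_quad (u * x) (by positivity)
    rw [← neg_mul] at h1
    have h2 : x ^ (1 - α) = x ^ 2 * x ^ (-1 - α) := by
      rw [← Real.rpow_natCast, ← Real.rpow_add hx0]; congr 1; push_cast; ring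
    rw [h2, ← mul_assoc, ← mul_pow]
    exact mul_le_mul_of_nonneg_right h1 (Real.rpow_nonneg hx0.le _)
  · have hi : IntegrableOn (fun x : ℝ => u * x ^ (-α)) (Set.Ioi 1) :=
      (integrableOn_Ioi_rpow_of_lt (by linarith) one_pos).const_mul u
    refine Integrable.mono' hi ((hc.mono (Set.Ioi_subset_Ioi zero_le_one)).aestronglyMeasurable
      measurableSet_Ioi) ?_
    refine (ae_restrict_iff' measurableSet_Ioi).2 (Filter.Eventually.of_forall ?_)
    intro x hx
    have hx0 : 0 < x := lt_trans one_pos hx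
    rw [Real.norm_of_nonneg (mul_nonneg (hnn x) (Real.rpow_nonneg hx0.le _))]
    have h1 : Real.exp (-u * x) - 1 + u * x ≤ u * x := by
      have : Real.exp (-u * x) ≤ 1 := Real.exp_le_one_iff.2 (by nlinarith [mul_pos hu hx0])
      linarith
    have h2 : x ^ (-α) = x * x ^ (-1 - α) := by
      nth_rewrite 2 [← Real.rpow_one x]
      rw [← Real.rpow_add hx0]; congr 1; ring
    rw [h2, ← mul_assoc]
    exact mul_le_mul_of_nonneg_right h1 (Real.rpow_nonneg hx0.le _)

lemma aux_deriv (α u x : ℝ) (hα : 1 < α) (hx : 0 < x) :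
    HasDerivAt (fun x : ℝ => -((Real.exp (-u * x) - 1 + u * x) * x ^ (-α)) / α
        - u * (1 - Real.exp (-u * x)) * x ^ (1 - α) / (α * (α - 1)))
      ((Real.exp (-u * x) - 1 + u * x) * x ^ (-1 - α)
        - u ^ 2 / (α * (α - 1)) * (x ^ (1 - α) * Real.exp (-u * x))) x := by
  have hE : HasDerivAt (fun x : ℝ => Real.exp (-u * x)) (Real.exp (-u * x) * (-u * 1)) x :=
    ((hasDerivAt_id x).const_mul (-u)).exp
  have hφ := (hE.sub_const 1).add ((hasDerivAt_id x).const_mul u)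
  have hp := Real.hasDerivAt_rpow_const (x := x) (p := -α) (Or.inl hx.ne')
  have hq := Real.hasDerivAt_rpow_const (x := x) (p := 1 - α) (Or.inl hx.ne')
  have h := (((hφ.mul hp).neg).div_const α).sub
    ((((hE.const_sub 1).const_mul u).mul hq).div_const (α * (α - 1)))
  refine h.congr_deriv ?_
  have e1 : (1 - α - 1) = -α := by ring
  have e2 : (-α - 1) = -1 - α := by ring
  have h1 : α ≠ 0 := by linarith
  have h2 : α - 1 ≠ 0 := by linarith
  simp only [e1, e2, Pi.add_apply, id]
  field_simp
  ring

lemma aux_bound0 (α u x : ℝ) (hα : 1 < α) (hu : 0 < u) (hx : 0 < x) :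
    ‖-((Real.exp (-u * x) - 1 + u * x) * x ^ (-α)) / α
        - u * (1 - Real.exp (-u * x)) * x ^ (1 - α) / (α * (α - 1))‖
      ≤ (u ^ 2 / α + u ^ 2 / (α * (α - 1))) * x ^ (2 - α) := by
  have hpos : 0 < α * (α - 1) := mul_pos (by linarith) (by linarith)
  have h1 := aux_exp_quad (u * x) (by positivity)
  have h2 := Real.add_one_le_exp (-u * x)
  rw [← neg_mul] at h1
  have h3 : Real.exp (-u * x) ≤ 1 := Real.exp_le_one_iff.2 (by nlinarith [mul_pos hu hx])
  have e1 : x ^ (2 - α) = x ^ 2 * x ^ (-α) := by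
    rw [← Real.rpow_natCast, ← Real.rpow_add hx]; congr 1
  have e2 : x ^ (2 - α) = x * x ^ (1 - α) := by
    nth_rewrite 2 [← Real.rpow_one x]
    rw [← Real.rpow_add hx]; congr 1; ring
  have p1 : 0 ≤ x ^ (-α) := Real.rpow_nonneg hx.le _
  have p2 : 0 ≤ x ^ (1 - α) := Real.rpow_nonneg hx.le _
  have b1 : (Real.exp (-u * x) - 1 + u * x) * x ^ (-α) / α ≤ u ^ 2 / α * x ^ (2 - α) := by
    rw [e1, div_mul_eq_mul_div, ← mul_assoc, ← mul_pow]
    gcongr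
  have b2 : u * (1 - Real.exp (-u * x)) * x ^ (1 - α) / (α * (α - 1))
      ≤ u ^ 2 / (α * (α - 1)) * x ^ (2 - α) := by
    rw [e2, div_mul_eq_mul_div, ← mul_assoc]
    have : u * (1 - Real.exp (-u * x)) ≤ u ^ 2 * x := by nlinarith
    gcongr
  have n1 : 0 ≤ (Real.exp (-u * x) - 1 + u * x) * x ^ (-α) / α :=
    div_nonneg (mul_nonneg (by linarith) p1) (by linarith)
  have n2 : 0 ≤ u * (1 - Real.exp (-u * x)) * x ^ (1 - α) / (α * (α - 1)) :=
    div_nonneg (mul_nonneg (mul_nonneg hu.le (by linarith)) p2) hpos.le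
  rw [Real.norm_eq_abs, abs_le, neg_div]
  constructor <;> linarith

lemma aux_bound1 (α u x : ℝ) (hα : 1 < α) (hu : 0 < u) (hx : 0 < x) :
    ‖-((Real.exp (-u * x) - 1 + u * x) * x ^ (-α)) / α
        - u * (1 - Real.exp (-u * x)) * x ^ (1 - α) / (α * (α - 1))‖
      ≤ (u / α + u / (α * (α - 1))) * x ^ (-(α - 1)) := by
  have hpos : 0 < α * (α - 1) := mul_pos (by linarith) (by linarith)
  have h2 := Real.add_one_le_exp (-u * x)
  have h3 : Real.exp (-u * x) ≤ 1 := Real.exp_le_one_iff.2 (by nlinarith [mul_pos hu hx])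
  have h4 := Real.exp_pos (-u * x)
  have e0 : -(α - 1) = 1 - α := by ring
  rw [e0]
  have e1 : x ^ (1 - α) = x * x ^ (-α) := by
    nth_rewrite 2 [← Real.rpow_one x]
    rw [← Real.rpow_add hx]; congr 1
  have p1 : 0 ≤ x ^ (-α) := Real.rpow_nonneg hx.le _
  have p2 : 0 ≤ x ^ (1 - α) := Real.rpow_nonneg hx.le _
  have b1 : (Real.exp (-u * x) - 1 + u * x) * x ^ (-α) / α ≤ u / α * x ^ (1 - α) := by
    rw [e1, div_mul_eq_mul_div, ← mul_assoc]
    gcongr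
    linarith
  have b2 : u * (1 - Real.exp (-u * x)) * x ^ (1 - α) / (α * (α - 1))
      ≤ u / (α * (α - 1)) * x ^ (1 - α) := by
    rw [div_mul_eq_mul_div]
    have : u * (1 - Real.exp (-u * x)) ≤ u := by nlinarith
    gcongr
  have n1 : 0 ≤ (Real.exp (-u * x) - 1 + u * x) * x ^ (-α) / α :=
    div_nonneg (mul_nonneg (by linarith) p1) (by linarith)
  have n2 : 0 ≤ u * (1 - Real.exp (-u * x)) * x ^ (1 - α) / (α * (α - 1)) :=
    div_nonneg (mul_nonneg (mul_nonneg hu.le (by linarith)) p2) hpos.le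
  rw [Real.norm_eq_abs, abs_le, neg_div]
  constructor <;> linarith

/-- for `α ∈ (1,2)` and `u > 0`,
`∫₀^∞ (e^{-ux} - 1 + ux) x^{-1-α} dx = Γ(2-α)/(α(α-1)) · u^α`,
the integral being finite (Lebesgue integrable on `(0,∞)`). -/
theorem stmt14 (α u : ℝ) (hα : 1 < α) (hα2 : α < 2) (hu : 0 < u) :
    IntegrableOn (fun x : ℝ => (Real.exp (-u * x) - 1 + u * x) * x ^ (-1 - α))
        (Set.Ioi (0 : ℝ)) ∧
      ∫ x in Set.Ioi (0 : ℝ), (Real.exp (-u * x) - 1 + u * x) * x ^ (-1 - α)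
        = Real.Gamma (2 - α) / (α * (α - 1)) * u ^ α := by
  have hf := aux_int α u hα hα2 hu
  refine ⟨hf, ?_⟩
  have hg0 : IntegrableOn (fun x : ℝ => x ^ (1 - α) * Real.exp (-u * x)) (Set.Ioi 0) := by
    simpa using integrableOn_rpow_mul_exp_neg_mul_rpow (p := 1) (s := 1 - α) (by linarith)
      one_pos hu
  have hgi : ∫ x in Set.Ioi (0 : ℝ), x ^ (1 - α) * Real.exp (-u * x)
      = u ^ (-(2 - α)) * Real.Gamma (2 - α) := by
    have h := integral_rpow_mul_exp_neg_mul_rpow (p := 1) (q := 1 - α) (b := u) one_pos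
      (by linarith) hu
    have e : 1 - α + 1 = 2 - α := by ring
    simpa [e] using h
  have hg := hg0.const_mul (u ^ 2 / (α * (α - 1)))
  have key := integral_Ioi_of_hasDerivAt_of_tendsto (a := 0) (m := 0)
    (f := fun x : ℝ => -((Real.exp (-u * x) - 1 + u * x) * x ^ (-α)) / α
        - u * (1 - Real.exp (-u * x)) * x ^ (1 - α) / (α * (α - 1)))
    (f' := fun x : ℝ => (Real.exp (-u * x) - 1 + u * x) * x ^ (-1 - α)
        - u ^ 2 / (α * (α - 1)) * (x ^ (1 - α) * Real.exp (-u * x)))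
    ?_ (fun x hx => aux_deriv α u x hα hx) (hf.sub hg) ?_
  · rw [integral_sub hf hg, integral_const_mul, hgi] at key
    have e : u ^ α = u ^ 2 * u ^ (-(2 - α)) := by
      rw [← Real.rpow_natCast, ← Real.rpow_add hu]; congr 1; push_cast; ring
    rw [e]
    simp at key
    have key' := sub_eq_zero.1 key
    simp only [neg_mul, neg_sub]
    rw [key']
    ring
  · rw [← continuousWithinAt_Ioi_iff_Ici, ContinuousWithinAt]
    have h0 : Filter.Tendsto (fun x : ℝ => (u ^ 2 / α + u ^ 2 / (α * (α - 1))) * x ^ (2 - α))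
        (nhdsWithin 0 (Set.Ioi 0)) (nhds 0) := by
      have := ((Real.continuousAt_rpow_const 0 (2 - α) (Or.inr (by linarith))).tendsto.const_mul
        (u ^ 2 / α + u ^ 2 / (α * (α - 1))))
      rw [Real.zero_rpow (by linarith), mul_zero] at this
      exact this.mono_left nhdsWithin_le_nhds
    have := squeeze_zero_norm' (Filter.eventually_of_mem (self_mem_nhdsWithin (s := Set.Ioi (0 : ℝ)))
      (fun x hx => aux_bound0 α u x hα hu hx)) h0
    simpa using this
  · have h0 : Filter.Tendsto (fun x : ℝ => (u / α + u / (α * (α - 1))) * x ^ (-(α - 1)))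
        Filter.atTop (nhds 0) := by
      simpa using (tendsto_rpow_neg_atTop (y := α - 1) (by linarith)).const_mul
        (u / α + u / (α * (α - 1)))
    exact squeeze_zero_norm' (Filter.eventually_of_mem (Filter.Ioi_mem_atTop 0)
      (fun x hx => aux_bound1 α u x hα hu hx)) h0
end
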